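/- Let ℱ be a class of functions from a set Z to [−B, B], and σ₁,…,σₙ be i.i.d. Rademacher variables. For fixed points z₁,…,zₙ ∈ Z, the empirical Rademacher complexity R̂ₙ(ℱ) = E_σ[ sup_{f∈ℱ} (1/n)Σᵢ σᵢ f(zᵢ) ] satisfies the Dudley entropy bound: R̂ₙ(ℱ) ≤ inf_{δ ≥ 0} { 4δ + 12 ∫_δ^B √( log N(u, ℱ, L₂(Pₙ)) / n ) du }, where N(u, ℱ, L₂(Pₙ)) is the covering number of ℱ at scale u in the empirical L₂ metric. -/

import Mathlib

/-- Empirical L₂(Pₙ) pseudometric on functions, for sample points `z`. -/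
noncomputable def empL2Dist {Z : Type*} {n : ℕ} (z : Fin n → Z) (f g : Z → ℝ) : ℝ :=
  Real.sqrt ((1 / n : ℝ) * ∑ i : Fin n, (f (z i) - g (z i)) ^ 2)

/-- Covering number of a function class `F` at scale `u` in the metric `dist`. -/
noncomputable def covNum {Z : Type*} (u : ℝ) (F : Set (Z → ℝ))
    (dist : (Z → ℝ) → (Z → ℝ) → ℝ) : ℕ :=
  sInf {m : ℕ | ∃ T : Finset (Z → ℝ), T.card = m ∧
    ∀ f ∈ F, ∃ g ∈ T, dist f g ≤ u}

/-- Empirical Rademacher complexity (expectation over uniform sign vectors). -/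
noncomputable def empRademacher {Z : Type*} {n : ℕ} (z : Fin n → Z)
    (F : Set (Z → ℝ)) : ℝ :=
  ((2 : ℝ) ^ n)⁻¹ * ∑ s : Fin n → Bool,
    sSup ((fun f => (1 / n : ℝ) *
      ∑ i : Fin n, (if s i then (1 : ℝ) else -1) * f (z i)) '' F)

noncomputable def radAvg {n : ℕ} (s : Fin n → Bool) (a : Fin n → ℝ) : ℝ :=
  (1 / n : ℝ) * ∑ i : Fin n, (if s i then (1 : ℝ) else -1) * a i

lemma radAvg_add {n : ℕ} (s : Fin n → Bool) (a b : Fin n → ℝ) :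
    radAvg s (fun i => a i + b i) = radAvg s a + radAvg s b := by
  simp only [radAvg, mul_add, Finset.sum_add_distrib]

lemma radAvg_sub {n : ℕ} (s : Fin n → Bool) (a b : Fin n → ℝ) :
    radAvg s (fun i => a i - b i) = radAvg s a - radAvg s b := by
  simp only [radAvg, mul_sub, Finset.sum_sub_distrib]

lemma sum_exp_radAvg {n : ℕ} (hn : 0 < n) (a : Fin n → ℝ) (t r : ℝ)
    (ha : (1 / n : ℝ) * ∑ i, a i ^ 2 ≤ r ^ 2) :
    ∑ s : Fin n → Bool, Real.exp (t * radAvg s a) ≤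
      2 ^ n * Real.exp (t ^ 2 * (r ^ 2 / n) / 2) := by
  have hn' : (0 : ℝ) < n := by exact_mod_cast hn
  have h1 : ∀ s : Fin n → Bool, Real.exp (t * radAvg s a) =
      ∏ i, Real.exp ((if s i then (1 : ℝ) else -1) * (t / n * a i)) := by
    intro s
    rw [← Real.exp_sum, radAvg, ← mul_assoc, Finset.mul_sum]
    congr 1
    apply Finset.sum_congr rfl
    intro i _
    ring
  simp_rw [h1]
  have h2 := Fintype.prod_sum (fun (i : Fin n) (b : Bool) =>
    Real.exp ((if b then (1 : ℝ) else -1) * (t / n * a i)))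
  rw [← h2]
  calc ∏ i, ∑ b : Bool, Real.exp ((if b then (1 : ℝ) else -1) * (t / n * a i))
      ≤ ∏ i, (2 * Real.exp ((t / n * a i) ^ 2 / 2)) := by
        apply Finset.prod_le_prod
        · intro i _; positivity
        · intro i _
          have := Real.cosh_le_exp_half_sq (t / n * a i)
          rw [Real.cosh_eq] at this
          simp
          linarith
    _ = 2 ^ n * Real.exp (∑ i, (t / n * a i) ^ 2 / 2) := by
        rw [Finset.prod_mul_distrib, Real.exp_sum]; simp
    _ ≤ _ := by
        gcongr
        have : ∑ i, (t / n * a i) ^ 2 / 2 = t ^ 2 * (((1 / n : ℝ) * ∑ i, a i ^ 2) / n) / 2 := by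
          rw [Finset.mul_sum, Finset.sum_div, Finset.mul_sum, Finset.sum_div]
          apply Finset.sum_congr rfl
          intro i _
          field_simp
        rw [this]
        gcongr

lemma opt_bound (E L c : ℝ) (hL : 0 ≤ L) (hc : 0 < c)
    (h : ∀ t : ℝ, 0 < t → t * E ≤ L + t ^ 2 * c / 2) : E ≤ Real.sqrt (2 * L * c) := by
  rcases hL.eq_or_lt with rfl | hL
  · simp
    by_contra hE
    push Not at hE
    have := h (E / c) (by positivity)
    have h2 : E / c * E = E ^ 2 / c := by ring
    have h3 : (E / c) ^ 2 * c / 2 = E ^ 2 / c / 2 := by field_simp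
    rw [h2, h3] at this
    have : 0 < E ^ 2 / c := by positivity
    linarith
  · have h1 := h (Real.sqrt (2 * L / c)) (by positivity)
    rw [Real.sq_sqrt (by positivity)] at h1
    have h2 : 2 * L / c * c / 2 = L := by field_simp
    rw [h2] at h1
    have h3 : Real.sqrt (2 * L / c) * Real.sqrt (2 * L * c) = 2 * L := by
      rw [← Real.sqrt_mul (by positivity)]
      rw [show 2 * L / c * (2 * L * c) = (2 * L) ^ 2 by field_simp]
      exact Real.sqrt_sq (by positivity)
    have h4 : 0 < Real.sqrt (2 * L / c) := by positivity
    by_contra hE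
    push Not at hE
    nlinarith [mul_lt_mul_of_pos_left hE h4]

lemma massart {n : ℕ} (hn : 0 < n) {ι : Type*} (P : Finset ι) (hP : P.Nonempty)
    (a : ι → Fin n → ℝ) (r L : ℝ) (hr : 0 < r) (hL : 0 ≤ L)
    (hcard : (P.card : ℝ) ≤ Real.exp L)
    (ha : ∀ p ∈ P, (1 / n : ℝ) * ∑ i, a p i ^ 2 ≤ r ^ 2) :
    ((2 : ℝ) ^ n)⁻¹ * ∑ s : Fin n → Bool, P.sup' hP (fun p => radAvg s (a p)) ≤
      r * Real.sqrt (2 * L / n) := by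
  have hn' : (0 : ℝ) < n := by exact_mod_cast hn
  have key : r * Real.sqrt (2 * L / n) = Real.sqrt (2 * L * (r ^ 2 / n)) := by
    rw [show 2 * L * (r ^ 2 / n) = r ^ 2 * (2 * L / n) by ring,
      Real.sqrt_mul (by positivity), Real.sqrt_sq hr.le]
  rw [key]
  apply opt_bound _ _ _ hL (by positivity)
  intro t ht
  set K := L + t ^ 2 * (r ^ 2 / n) / 2 with hK
  set M : (Fin n → Bool) → ℝ := fun s => P.sup' hP (fun p => radAvg s (a p)) with hM
  have h1 : ∀ s, t * M s - K ≤ Real.exp (-K) * ∑ p ∈ P, Real.exp (t * radAvg s (a p)) - 1 := by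
    intro s
    obtain ⟨p, hp, hpe⟩ := Finset.exists_mem_eq_sup' hP (fun p => radAvg s (a p))
    have e1 := Real.add_one_le_exp (t * M s - K)
    have e2 : Real.exp (t * M s - K) = Real.exp (-K) * Real.exp (t * radAvg s (a p)) := by
      rw [← Real.exp_add, hM]
      simp only [hpe]
      ring_nf
    have e3 : Real.exp (t * radAvg s (a p)) ≤ ∑ p ∈ P, Real.exp (t * radAvg s (a p)) :=
      Finset.single_le_sum (f := fun p => Real.exp (t * radAvg s (a p)))
        (fun _ _ => (Real.exp_pos _).le) hp
    have e4 := mul_le_mul_of_nonneg_left e3 (Real.exp_pos (-K)).le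
    linarith
  have h2 : ∑ s : Fin n → Bool, ∑ p ∈ P, Real.exp (t * radAvg s (a p)) ≤ 2 ^ n * Real.exp K := by
    rw [Finset.sum_comm]
    calc _ ≤ ∑ p ∈ P, 2 ^ n * Real.exp (t ^ 2 * (r ^ 2 / n) / 2) :=
          Finset.sum_le_sum fun p hp => sum_exp_radAvg hn (a p) t r (ha p hp)
      _ = P.card * (2 ^ n * Real.exp (t ^ 2 * (r ^ 2 / n) / 2)) := by simp
      _ ≤ Real.exp L * (2 ^ n * Real.exp (t ^ 2 * (r ^ 2 / n) / 2)) := by gcongr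
      _ = _ := by rw [hK, Real.exp_add]; ring
  have h3 := Finset.sum_le_sum (fun s (_ : s ∈ (Finset.univ : Finset (Fin n → Bool))) => h1 s)
  rw [Finset.sum_sub_distrib, Finset.sum_sub_distrib, ← Finset.mul_sum, ← Finset.mul_sum] at h3
  simp only [Finset.sum_const, Finset.card_univ, Fintype.card_fun, Fintype.card_bool,
    Fintype.card_fin, nsmul_eq_mul, Nat.cast_pow, Nat.cast_ofNat, mul_one] at h3
  have h4 := mul_le_mul_of_nonneg_left h2 (Real.exp_pos (-K)).le
  have h5 : Real.exp (-K) * (2 ^ n * Real.exp K) = 2 ^ n := by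
    rw [Real.exp_neg]; field_simp
  rw [h5] at h4
  have h6 : (0 : ℝ) < 2 ^ n := by positivity
  rw [← mul_assoc, mul_comm t, mul_assoc, inv_mul_le_iff₀ h6]
  linarith

lemma empL2Dist_nonneg {Z : Type*} {n : ℕ} (z : Fin n → Z) (f g : Z → ℝ) :
    0 ≤ empL2Dist z f g := Real.sqrt_nonneg _

lemma empL2Dist_comm {Z : Type*} {n : ℕ} (z : Fin n → Z) (f g : Z → ℝ) :
    empL2Dist z f g = empL2Dist z g f := by
  unfold empL2Dist
  congr 2
  exact Finset.sum_congr rfl fun i _ => by ring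

lemma empL2Dist_eq {Z : Type*} {n : ℕ} (z : Fin n → Z) (f g : Z → ℝ) :
    empL2Dist z f g = Real.sqrt (1 / n) *
      dist (WithLp.toLp 2 (fun i => f (z i)) : EuclideanSpace ℝ (Fin n))
        (WithLp.toLp 2 (fun i => g (z i))) := by
  rw [EuclideanSpace.dist_eq, empL2Dist, Real.sqrt_mul (by positivity)]
  simp [Real.dist_eq, sq_abs]

lemma empL2Dist_triangle {Z : Type*} {n : ℕ} (z : Fin n → Z) (f g h : Z → ℝ) :
    empL2Dist z f h ≤ empL2Dist z f g + empL2Dist z g h := by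
  simp only [empL2Dist_eq]
  rw [← mul_add]
  gcongr
  exact dist_triangle _ _ _

lemma empL2Dist_le_of_forall {Z : Type*} {n : ℕ} (hn : 0 < n) (z : Fin n → Z) (f g : Z → ℝ)
    (u : ℝ) (hu : 0 ≤ u) (h : ∀ i, |f (z i) - g (z i)| ≤ u) : empL2Dist z f g ≤ u := by
  have hn' : (0 : ℝ) < n := by exact_mod_cast hn
  apply Real.sqrt_le_iff.2 ⟨hu, ?_⟩
  have : ∑ i : Fin n, (f (z i) - g (z i)) ^ 2 ≤ ∑ i : Fin n, u ^ 2 := by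
    apply Finset.sum_le_sum
    intro i _
    exact sq_le_sq' (abs_le.1 (h i)).1 (abs_le.1 (h i)).2
  simp at this
  rw [one_div, inv_mul_le_iff₀ hn']
  exact this

lemma radAvg_le_dist {Z : Type*} {n : ℕ} (hn : 0 < n) (z : Fin n → Z) (f g : Z → ℝ)
    (s : Fin n → Bool) :
    radAvg s (fun i => f (z i) - g (z i)) ≤ empL2Dist z f g := by
  have hn' : (0 : ℝ) < n := by exact_mod_cast hn
  apply Real.le_sqrt_of_sq_le
  rw [radAvg, mul_pow]
  have h := sq_sum_le_card_mul_sum_sq (s := (Finset.univ : Finset (Fin n)))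
    (f := fun i => (if s i then (1 : ℝ) else -1) * (f (z i) - g (z i)))
  have h2 : ∀ i, ((if s i then (1 : ℝ) else -1) * (f (z i) - g (z i))) ^ 2 =
    (f (z i) - g (z i)) ^ 2 := by intro i; split_ifs <;> ring
  simp only [h2, Finset.card_univ, Fintype.card_fin] at h
  calc _ ≤ (1 / n : ℝ) ^ 2 * (n * ∑ i, (f (z i) - g (z i)) ^ 2) := by gcongr
    _ = _ := by field_simp

section cov
variable {Z : Type*} {n : ℕ} {z : Fin n → Z} {F : Set (Z → ℝ)}

lemma covNum_le {u : ℝ} (T : Finset (Z → ℝ)) (hT : ∀ f ∈ F, ∃ g ∈ T, empL2Dist z f g ≤ u) :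
    covNum u F (empL2Dist z) ≤ T.card := Nat.sInf_le ⟨T, rfl, hT⟩

lemma covNum_spec (htb : ∀ u : ℝ, 0 < u → ∃ T : Finset (Z → ℝ),
      ∀ f ∈ F, ∃ g ∈ T, empL2Dist z f g ≤ u) {u : ℝ} (hu : 0 < u) :
    ∃ T : Finset (Z → ℝ), T.card = covNum u F (empL2Dist z) ∧
      ∀ f ∈ F, ∃ g ∈ T, empL2Dist z f g ≤ u := by
  obtain ⟨T, hT⟩ := htb u hu
  exact Nat.sInf_mem (s := {m : ℕ | ∃ T : Finset (Z → ℝ), T.card = m ∧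
    ∀ f ∈ F, ∃ g ∈ T, empL2Dist z f g ≤ u}) ⟨T.card, T, rfl, hT⟩

lemma covNum_pos (hF : F.Nonempty) (htb : ∀ u : ℝ, 0 < u → ∃ T : Finset (Z → ℝ),
      ∀ f ∈ F, ∃ g ∈ T, empL2Dist z f g ≤ u) {u : ℝ} (hu : 0 < u) :
    1 ≤ covNum u F (empL2Dist z) := by
  obtain ⟨T, hT, hc⟩ := covNum_spec htb hu
  obtain ⟨f, hf⟩ := hF
  obtain ⟨g, hg, _⟩ := hc f hf
  rw [← hT]
  exact Finset.card_pos.2 ⟨g, hg⟩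

lemma covNum_anti (htb : ∀ u : ℝ, 0 < u → ∃ T : Finset (Z → ℝ),
      ∀ f ∈ F, ∃ g ∈ T, empL2Dist z f g ≤ u) {u v : ℝ} (hu : 0 < u) (huv : u ≤ v) :
    covNum v F (empL2Dist z) ≤ covNum u F (empL2Dist z) := by
  obtain ⟨T, hT, hc⟩ := covNum_spec htb hu
  rw [← hT]
  apply covNum_le
  intro f hf
  obtain ⟨g, hg, h⟩ := hc f hf
  exact ⟨g, hg, h.trans huv⟩

lemma covNum_grid (hn : 0 < n) {B : ℝ} (hB : 0 < B)
    (hbd : ∀ f ∈ F, ∀ zz : Z, f zz ∈ Set.Icc (-B) B) {u : ℝ} (hu : 0 < u) :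
    (covNum u F (empL2Dist z) : ℝ) ≤ (2 * B / u + 2) ^ n := by
  classical
  let cell : (Z → ℝ) → (Fin n → ℤ) := fun f i => ⌊f (z i) / u⌋
  let G : Finset (Fin n → ℤ) := Fintype.piFinset fun _ => Finset.Icc ⌊-B / u⌋ ⌊B / u⌋
  let rep : (Fin n → ℤ) → (Z → ℝ) := fun c =>
    if h : ∃ f ∈ F, cell f = c then h.choose else 0
  have h1 : covNum u F (empL2Dist z) ≤ (G.image rep).card := by
    apply covNum_le
    intro f hf
    have hex : ∃ f' ∈ F, cell f' = cell f := ⟨f, hf, rfl⟩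
    refine ⟨rep (cell f), Finset.mem_image_of_mem _ ?_, ?_⟩
    · simp only [G, Fintype.mem_piFinset, Finset.mem_Icc]
      intro i
      have := hbd f hf (z i)
      exact ⟨Int.floor_le_floor (by gcongr; exact this.1), Int.floor_le_floor (by gcongr; exact this.2)⟩
    · have hr : rep (cell f) = hex.choose := dif_pos hex
      have hs := hex.choose_spec.2
      rw [← hr] at hs
      apply empL2Dist_le_of_forall hn z _ _ u hu.le
      intro i
      have hi : ⌊rep (cell f) (z i) / u⌋ = ⌊f (z i) / u⌋ := congrFun hs i
      have := Int.abs_sub_lt_one_of_floor_eq_floor hi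
      rw [← sub_div, abs_div, abs_of_pos hu, div_lt_one hu, abs_sub_comm] at this
      exact this.le
  have h2 : (G.image rep).card ≤ (⌊B / u⌋ + 1 - ⌊-B / u⌋).toNat ^ n := by
    refine Finset.card_image_le.trans ?_
    simp [G, Fintype.card_piFinset]
  have h3 : (covNum u F (empL2Dist z) : ℝ) ≤ ((⌊B / u⌋ + 1 - ⌊-B / u⌋).toNat : ℝ) ^ n := by
    exact_mod_cast h1.trans h2
  refine h3.trans ?_
  gcongr
  have h0 : ⌊-B / u⌋ ≤ ⌊B / u⌋ := Int.floor_le_floor (by gcongr; linarith)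
  have : ((⌊B / u⌋ + 1 - ⌊-B / u⌋).toNat : ℝ) = ((⌊B / u⌋ + 1 - ⌊-B / u⌋ : ℤ) : ℝ) := by
    have := Int.toNat_of_nonneg (show 0 ≤ ⌊B / u⌋ + 1 - ⌊-B / u⌋ by omega)
    exact_mod_cast this
  rw [this]
  push_cast
  have a1 := Int.floor_le (B / u)
  have a2 := Int.lt_floor_add_one (-B / u)
  have a3 : -B / u = - (B / u) := by ring
  have a4 : 2 * B / u = 2 * (B / u) := by ring
  rw [a3] at a2
  rw [a4, a3]
  linarith

/-- The Dudley integrand. -/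
noncomputable def dud (z : Fin n → Z) (F : Set (Z → ℝ)) (u : ℝ) : ℝ :=
  Real.sqrt (Real.log (covNum u F (empL2Dist z)) / n)

lemma dud_nonneg (u : ℝ) : 0 ≤ dud z F u := Real.sqrt_nonneg _

lemma dud_anti (hF : F.Nonempty) (htb : ∀ u : ℝ, 0 < u → ∃ T : Finset (Z → ℝ),
      ∀ f ∈ F, ∃ g ∈ T, empL2Dist z f g ≤ u) : AntitoneOn (dud z F) (Set.Ioi 0) := by
  intro u hu v hv huv
  have h1 := covNum_anti htb hu huv
  have h2 := covNum_pos hF htb hv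
  unfold dud
  gcongr

lemma dud_integrable (hn : 0 < n) (hF : F.Nonempty) {B : ℝ} (hB : 0 < B)
    (hbd : ∀ f ∈ F, ∀ zz : Z, f zz ∈ Set.Icc (-B) B)
    (htb : ∀ u : ℝ, 0 < u → ∃ T : Finset (Z → ℝ),
      ∀ f ∈ F, ∃ g ∈ T, empL2Dist z f g ≤ u) (c : ℝ) (hc : 0 ≤ c) :
    IntervalIntegrable (dud z F) MeasureTheory.volume 0 c := by
  have hn' : (0 : ℝ) < n := by exact_mod_cast hn
  have hg : IntervalIntegrable (fun u : ℝ => (Real.sqrt (2 * B)) * u ^ (-(1/2) : ℝ) + Real.sqrt 2)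
      MeasureTheory.volume 0 c := by
    apply IntervalIntegrable.add
    · exact (intervalIntegral.intervalIntegrable_rpow' (by norm_num)).const_mul _
    · exact intervalIntegrable_const
  refine hg.mono_fun ?_ ?_
  · rw [Set.uIoc_of_le hc]
    apply AEMeasurable.aestronglyMeasurable
    exact aemeasurable_restrict_of_antitoneOn measurableSet_Ioc
      ((dud_anti hF htb).mono fun x hx => hx.1)
  · rw [Set.uIoc_of_le hc]
    filter_upwards [MeasureTheory.ae_restrict_mem measurableSet_Ioc] with u hu
    have hu0 : 0 < u := hu.1
    rw [Real.norm_of_nonneg (dud_nonneg u), Real.norm_of_nonneg (by positivity)]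
    have h1 := covNum_grid (z := z) hn hB hbd hu0
    have h2 : (1 : ℝ) ≤ covNum u F (empL2Dist z) := by exact_mod_cast covNum_pos hF htb hu0
    have h3 : Real.log (covNum u F (empL2Dist z)) / n ≤ 2 * B / u + 2 := by
      rw [div_le_iff₀ hn']
      calc _ ≤ Real.log ((2 * B / u + 2) ^ n) := Real.log_le_log (by linarith) h1
        _ = n * Real.log (2 * B / u + 2) := by rw [Real.log_pow]
        _ ≤ n * (2 * B / u + 2) := by
            gcongr
            exact Real.log_le_self (by positivity)
        _ = _ := by ring
    calc dud z F u ≤ Real.sqrt (2 * B / u + 2) := Real.sqrt_le_sqrt h3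
      _ ≤ Real.sqrt (2 * B / u) + Real.sqrt 2 := by
        have := Real.sqrt_nonneg (2 * B / u)
        apply Real.sqrt_le_iff.2 ⟨by positivity, ?_⟩
        nlinarith [Real.sq_sqrt (show (0:ℝ) ≤ 2 * B / u by positivity), Real.sq_sqrt (show (0:ℝ) ≤ 2 by norm_num), mul_nonneg this (Real.sqrt_nonneg 2)]
      _ = _ := by
        rw [Real.rpow_neg hu0.le, ← Real.sqrt_eq_rpow, Real.sqrt_div (by positivity)]
        rfl

end cov

section chain
variable {Z : Type*} {n : ℕ} {z : Fin n → Z} {F : Set (Z → ℝ)}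

lemma int_sub (hn : 0 < n) (hF : F.Nonempty) {B : ℝ} (hB : 0 < B)
    (hbd : ∀ f ∈ F, ∀ zz : Z, f zz ∈ Set.Icc (-B) B)
    (htb : ∀ u : ℝ, 0 < u → ∃ T : Finset (Z → ℝ),
      ∀ f ∈ F, ∃ g ∈ T, empL2Dist z f g ≤ u) {a b : ℝ} (ha : 0 ≤ a) (hb : 0 ≤ b) :
    IntervalIntegrable (dud z F) MeasureTheory.volume a b :=
  (dud_integrable hn hF hB hbd htb a ha).symm.trans (dud_integrable hn hF hB hbd htb b hb)

lemma sum_le_int (hn : 0 < n) (hF : F.Nonempty) {B : ℝ} (hB : 0 < B)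
    (hbd : ∀ f ∈ F, ∀ zz : Z, f zz ∈ Set.Icc (-B) B)
    (htb : ∀ u : ℝ, 0 < u → ∃ T : Finset (Z → ℝ),
      ∀ f ∈ F, ∃ g ∈ T, empL2Dist z f g ≤ u) (N : ℕ) :
    ∑ k ∈ Finset.range N, 6 * (B / 2 ^ (k + 1)) * dud z F (B / 2 ^ (k + 1)) ≤
      12 * ∫ u in (B / 2 ^ (N + 1))..(B / 2), dud z F u := by
  induction N with
  | zero => simp
  | succ N ih =>
    rw [Finset.sum_range_succ]
    have p1 : 0 < B / 2 ^ (N + 1) := by positivity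
    have p2 : 0 < B / 2 ^ (N + 1 + 1) := by positivity
    have p3 : B / 2 ^ (N + 1 + 1) = B / 2 ^ (N + 1) / 2 := by rw [pow_succ]; field_simp
    have hle : B / 2 ^ (N + 1 + 1) ≤ B / 2 ^ (N + 1) := by rw [p3]; linarith
    rw [← intervalIntegral.integral_add_adjacent_intervals
      (int_sub hn hF hB hbd htb p2.le p1.le)
      (int_sub hn hF hB hbd htb p1.le (by positivity : 0 ≤ B / 2)), mul_add]
    have h : (∫ u in (B / 2 ^ (N + 1 + 1))..(B / 2 ^ (N + 1)), dud z F (B / 2 ^ (N + 1))) ≤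
        ∫ u in (B / 2 ^ (N + 1 + 1))..(B / 2 ^ (N + 1)), dud z F u := by
      apply intervalIntegral.integral_mono_on hle intervalIntegrable_const
        (int_sub hn hF hB hbd htb p2.le p1.le)
      intro x hx
      exact dud_anti hF htb (Set.mem_Ioi.2 (p2.trans_le hx.1)) (Set.mem_Ioi.2 p1) hx.2
    rw [intervalIntegral.integral_const, smul_eq_mul] at h
    have e : B / 2 ^ (N + 1) - B / 2 ^ (N + 1 + 1) = B / 2 ^ (N + 1) / 2 := by rw [p3]; ring
    rw [e] at h
    linarith

lemma chain (hn : 0 < n) (hF : F.Nonempty) {B : ℝ} (hB : 0 < B)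
    (hbd : ∀ f ∈ F, ∀ zz : Z, f zz ∈ Set.Icc (-B) B)
    (htb : ∀ u : ℝ, 0 < u → ∃ T : Finset (Z → ℝ),
      ∀ f ∈ F, ∃ g ∈ T, empL2Dist z f g ≤ u) (N : ℕ) :
    empRademacher z F ≤ B / 2 ^ N +
      ∑ k ∈ Finset.range N, 6 * (B / 2 ^ (k + 1)) * dud z F (B / 2 ^ (k + 1)) := by
  classical
  have hn' : (0 : ℝ) < n := by exact_mod_cast hn
  have hT : ∀ j : ℕ, ∃ T : Finset (Z → ℝ), T.card ≤ covNum (B / 2 ^ j) F (empL2Dist z) ∧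
      (∀ f ∈ F, ∃ g ∈ T, empL2Dist z f g ≤ B / 2 ^ j) ∧ (j = 0 → T = {0}) := by
    intro j
    have hp : 0 < B / 2 ^ j := by positivity
    by_cases hj : j = 0
    · subst hj
      refine ⟨{0}, by simpa using covNum_pos hF htb hp, ?_, fun _ => rfl⟩
      intro f hf
      refine ⟨0, by simp, ?_⟩
      apply empL2Dist_le_of_forall hn _ _ _ _ hp.le
      intro i
      simpa using abs_le.2 (hbd f hf (z i))
    · obtain ⟨T, h1, h2⟩ := covNum_spec htb hp
      exact ⟨T, h1.le, h2, fun h => absurd h hj⟩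
  choose T hTc hTcov hT0 using hT
  let P : ℕ → Finset ((Z → ℝ) × (Z → ℝ)) := fun k =>
    ((T (k + 1)) ×ˢ (T k)).filter fun p => empL2Dist z p.1 p.2 ≤ 3 * (B / 2 ^ (k + 1))
  have hmem : ∀ k, ∀ f ∈ F, ∀ g ∈ T (k + 1), ∀ h ∈ T k, empL2Dist z f g ≤ B / 2 ^ (k + 1) →
      empL2Dist z f h ≤ B / 2 ^ k → (g, h) ∈ P k := by
    intro k f hf g hg h hh d1 d2
    simp only [P, Finset.mem_filter, Finset.mem_product]
    refine ⟨⟨hg, hh⟩, ?_⟩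
    have t := empL2Dist_triangle z g f h
    rw [empL2Dist_comm z g f] at t
    have e : B / 2 ^ k = 2 * (B / 2 ^ (k + 1)) := by rw [pow_succ]; field_simp
    linarith
  have hPne : ∀ k, (P k).Nonempty := by
    intro k
    obtain ⟨f, hf⟩ := hF
    obtain ⟨g, hg, d1⟩ := hTcov (k + 1) f hf
    obtain ⟨h, hh, d2⟩ := hTcov k f hf
    exact ⟨(g, h), hmem k f hf g hg h hh d1 d2⟩
  let M : ℕ → (Fin n → Bool) → ℝ := fun k s =>
    (P k).sup' (hPne k) fun p => radAvg s (fun i => p.1 (z i) - p.2 (z i))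
  have hM : ∀ k, ((2 : ℝ) ^ n)⁻¹ * ∑ s : Fin n → Bool, M k s ≤
      6 * (B / 2 ^ (k + 1)) * dud z F (B / 2 ^ (k + 1)) := by
    intro k
    have p1 : 0 < B / 2 ^ (k + 1) := by positivity
    have c1 := covNum_pos hF htb p1
    have c1' : (1 : ℝ) ≤ covNum (B / 2 ^ (k + 1)) F (empL2Dist z) := by exact_mod_cast c1
    have hl := Real.log_nonneg c1'
    have := massart hn (P k) (hPne k) (fun p i => p.1 (z i) - p.2 (z i))
      (3 * (B / 2 ^ (k + 1))) (2 * Real.log (covNum (B / 2 ^ (k + 1)) F (empL2Dist z)))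
      (by positivity) (by positivity) ?_ ?_
    · refine this.trans (le_of_eq ?_)
      rw [dud, show 2 * (2 * Real.log (covNum (B / 2 ^ (k + 1)) F (empL2Dist z))) / (n : ℝ) =
        2 ^ 2 * (Real.log (covNum (B / 2 ^ (k + 1)) F (empL2Dist z)) / n) by ring,
        Real.sqrt_mul (by positivity), Real.sqrt_sq (by norm_num)]
      ring
    · have : (P k).card ≤ covNum (B / 2 ^ (k + 1)) F (empL2Dist z) *
          covNum (B / 2 ^ (k + 1)) F (empL2Dist z) := by
        refine (Finset.card_filter_le _ _).trans ?_
        rw [Finset.card_product]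
        refine Nat.mul_le_mul (hTc _) ((hTc k).trans (covNum_anti htb p1 ?_))
        gcongr
        · norm_num
        · omega
      rw [two_mul, Real.exp_add, Real.exp_log (by linarith)]
      exact_mod_cast this
    · intro p hp
      have h := (Finset.mem_filter.1 hp).2
      exact (Real.sqrt_le_iff.1 h).2
  have hpt : ∀ s : Fin n → Bool, sSup ((fun f : Z → ℝ => (1 / n : ℝ) *
      ∑ i : Fin n, (if s i then (1 : ℝ) else -1) * f (z i)) '' F) ≤
      B / 2 ^ N + ∑ k ∈ Finset.range N, M k s := by
    intro s
    apply csSup_le (hF.image _)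
    rintro _ ⟨f, hf, rfl⟩
    change radAvg s (fun i => f (z i)) ≤ _
    choose π hπ hπd using fun j => hTcov j f hf
    have hind : ∀ m, radAvg s (fun i => π m (z i)) ≤ ∑ k ∈ Finset.range m, M k s := by
      intro m
      induction m with
      | zero =>
        have h0 : π 0 = 0 := by
          have := hπ 0
          rw [hT0 0 rfl] at this
          simpa using this
        simp [h0, radAvg]
      | succ m ih =>
        rw [Finset.sum_range_succ]
        have := Finset.le_sup' (fun p : (Z → ℝ) × (Z → ℝ) =>
          radAvg s (fun i => p.1 (z i) - p.2 (z i)))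
          (hmem m f hf _ (hπ (m + 1)) _ (hπ m) (hπd _) (hπd _))
        have h2 : radAvg s (fun i => π (m + 1) (z i) - π m (z i)) ≤ M m s := this
        rw [radAvg_sub] at h2
        linarith
    have h1 := radAvg_le_dist hn z f (π N) s
    rw [radAvg_sub] at h1
    have := hπd N
    have := hind N
    linarith
  calc empRademacher z F ≤ ((2 : ℝ) ^ n)⁻¹ * ∑ s : Fin n → Bool,
        (B / 2 ^ N + ∑ k ∈ Finset.range N, M k s) := by
        unfold empRademacher
        gcongr with s _
        exact hpt s
    _ = B / 2 ^ N + ∑ k ∈ Finset.range N, ((2 : ℝ) ^ n)⁻¹ * ∑ s : Fin n → Bool, M k s := by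
        rw [Finset.sum_add_distrib, mul_add, Finset.sum_comm, ← Finset.mul_sum]
        congr 1
        simp
    _ ≤ _ := by
        have := Finset.sum_le_sum fun k (_ : k ∈ Finset.range N) => hM k
        linarith

lemma chain' (hn : 0 < n) (hF : F.Nonempty) {B : ℝ} (hB : 0 < B)
    (hbd : ∀ f ∈ F, ∀ zz : Z, f zz ∈ Set.Icc (-B) B)
    (htb : ∀ u : ℝ, 0 < u → ∃ T : Finset (Z → ℝ),
      ∀ f ∈ F, ∃ g ∈ T, empL2Dist z f g ≤ u) (N : ℕ) (δ : ℝ) (hδ : 0 ≤ δ)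
      (hδN : δ ≤ B / 2 ^ (N + 1)) :
    empRademacher z F ≤ B / 2 ^ N + 12 * ∫ u in δ..B, dud z F u := by
  have h1 := chain hn hF hB hbd htb N
  have h2 := sum_le_int hn hF hB hbd htb N
  have h3 : (∫ u in (B / 2 ^ (N + 1))..(B / 2), dud z F u) ≤ ∫ u in δ..B, dud z F u := by
    apply intervalIntegral.integral_mono_interval hδN _ (by linarith) _
      (int_sub hn hF hB hbd htb hδ hB.le)
    · apply div_le_div_of_nonneg_left hB.le (by norm_num)
      exact le_self_pow₀ (by norm_num) (by omega)
    · exact Filter.Eventually.of_forall fun u => dud_nonneg u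
  linarith

lemma dud_zero (hn : 0 < n) (hF : F.Nonempty) {B : ℝ} (hB : 0 < B)
    (hbd : ∀ f ∈ F, ∀ zz : Z, f zz ∈ Set.Icc (-B) B)
    {u : ℝ} (hu : B ≤ u) : dud z F u = 0 := by
  have h : covNum u F (empL2Dist z) ≤ ({0} : Finset (Z → ℝ)).card := by
    apply covNum_le
    intro f hf
    refine ⟨0, by simp, ?_⟩
    apply empL2Dist_le_of_forall hn _ _ _ _ (by linarith)
    intro i
    simpa using (abs_le.2 (hbd f hf (z i))).trans hu
  simp only [Finset.card_singleton] at h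
  unfold dud
  interval_cases covNum u F (empL2Dist z) <;> simp

end chain

/-- Dudley entropy integral bound: for a class F of functions with
values in [-B, B], the empirical Rademacher complexity is bounded by
inf_{δ ≥ 0} { 4δ + 12 ∫_δ^B √(log N(u, F, L₂(Pₙ)) / n) du }. -/
theorem stmt_8 {Z : Type*} (n : ℕ) (hn : 0 < n) (z : Fin n → Z)
    (F : Set (Z → ℝ)) (hF : F.Nonempty) (B : ℝ) (hB : 0 < B)
    (hbd : ∀ f ∈ F, ∀ zz : Z, f zz ∈ Set.Icc (-B) B)
    (htb : ∀ u : ℝ, 0 < u → ∃ T : Finset (Z → ℝ),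
      ∀ f ∈ F, ∃ g ∈ T, empL2Dist z f g ≤ u) :
    ∀ δ : ℝ, 0 ≤ δ →
      empRademacher z F ≤ 4 * δ +
        12 * ∫ u in δ..B,
          Real.sqrt (Real.log (covNum u F (empL2Dist z)) / n) := by
  intro δ hδ
  change empRademacher z F ≤ 4 * δ + 12 * ∫ u in δ..B, dud z F u
  rcases hδ.eq_or_lt with rfl | hδ0
  · apply le_of_forall_pos_le_add
    intro ε hε
    obtain ⟨N, hN⟩ := exists_pow_lt_of_lt_one (show 0 < ε / B by positivity)
      (show (1 / 2 : ℝ) < 1 by norm_num)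
    have h := chain' hn hF hB hbd htb N 0 le_rfl (by positivity)
    have h2 : B / 2 ^ N < ε := by
      rw [lt_div_iff₀ hB, one_div, inv_pow] at hN
      rw [div_eq_mul_inv, mul_comm]
      exact hN
    linarith
  · rcases le_or_gt B (4 * δ) with h4 | h4
    · have h := chain hn hF hB hbd htb 0
      simp only [pow_zero, div_one, Finset.range_zero, Finset.sum_empty, add_zero] at h
      have h0 : 0 ≤ ∫ u in δ..B, dud z F u := by
        rcases le_total δ B with hl | hl
        · exact intervalIntegral.integral_nonneg hl fun u _ => dud_nonneg u
        · rw [intervalIntegral.integral_symm, intervalIntegral.integral_congr (g := fun _ => 0)]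
          · simp
          · intro u hu
            rw [Set.uIcc_of_le hl] at hu
            exact dud_zero hn hF hB hbd hu.1
      linarith
    · obtain ⟨m, h1, h2⟩ := exists_nat_pow_near (x := B / (4 * δ)) (y := 2)
        ((one_le_div (by positivity)).2 h4.le) (by norm_num)
      rw [le_div_iff₀ (by positivity)] at h1
      rw [div_lt_iff₀ (by positivity)] at h2
      have h := chain' hn hF hB hbd htb (m + 1) δ hδ (by
        rw [le_div_iff₀ (by positivity)]
        calc δ * 2 ^ (m + 1 + 1) = 2 ^ m * (4 * δ) := by ring
          _ ≤ B := h1)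
      have h3 : B / 2 ^ (m + 1) ≤ 4 * δ := by
        rw [div_le_iff₀ (by positivity)]
        linarith
      linarith
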